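/- arXiv:2007.01250 — 6 statements merged into one kernel-verified Lean document; each statement's English description precedes it below -/
import Mathlib

section
/- Let H be a complex Hilbert space, let T be a densely defined self-adjoint operator on H, and let T¹ and T² be symmetric operators whose domains contain D(T) and which are T-bounded, i.e. for j = 1,2 there exist constants a_j, b_j ≥ 0 such that ‖T^{(j)}x‖ ≤ a_j‖x‖ + b_j‖Tx‖ for all x ∈ D(T). For κ ∈ ℝ let T(κ) = T + κT¹ + κ²T² with domain D(T). Let t ≥ 0. If for every κ ∈ [0,t] the operator T(κ) is closed (its graph is a closed subspace of H × H), then T(t) is self-adjoint. -/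
open LinearPMap

/-- The perturbed operator `T(κ) = T + κ T¹ + κ² T²` with domain `D(T)`. -/
noncomputable def pertOp {H : Type*} [NormedAddCommGroup H] [InnerProductSpace ℂ H]
    (T T1 T2 : H →ₗ.[ℂ] H) (h1 : T.domain ≤ T1.domain) (h2 : T.domain ≤ T2.domain)
    (κ : ℂ) : H →ₗ.[ℂ] H :=
  ⟨T.domain, T.toFun + κ • (T1.toFun ∘ₗ Submodule.inclusion h1)
      + κ ^ 2 • (T2.toFun ∘ₗ Submodule.inclusion h2)⟩

open Topology

theorem aux_surj {E F : Type*} [NormedAddCommGroup E] [NormedSpace ℂ E] [CompleteSpace E]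
    [NormedAddCommGroup F] [NormedSpace ℂ F] [CompleteSpace F] (A B : E →L[ℂ] F) (c : ℝ)
    (hc : 0 < c) (hB : ∀ x, c * ‖x‖ ≤ ‖B x‖) (hs : Function.Surjective B)
    (hAB : ‖A - B‖ < c) : Function.Surjective A := by
  have hinj : Function.Injective B := by
    rw [injective_iff_map_eq_zero]
    intro x hx
    have := hB x
    rw [hx, norm_zero] at this
    exact norm_le_zero_iff.1 (by nlinarith [norm_nonneg x])
  let e := ContinuousLinearEquiv.ofBijective B (LinearMap.ker_eq_bot.2 hinj)
    (LinearMap.range_eq_top.2 hs)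
  have he : ∀ x, e x = B x := fun x => rfl
  -- R = (B - A) ∘ e.symm, 1 - R invertible
  let R : F →L[ℂ] F := (B - A) ∘L (e.symm : F →L[ℂ] E)
  have hR : ‖R‖ < 1 := by
    have : ‖R‖ ≤ ‖A - B‖ / c := by
      refine ContinuousLinearMap.opNorm_le_bound _ (by positivity) fun y => ?_
      have h1 : ‖R y‖ ≤ ‖B - A‖ * ‖e.symm y‖ := (B - A).le_opNorm _
      have h2 := hB (e.symm y)
      rw [← he, e.apply_symm_apply] at h2
      rw [norm_sub_rev] at h1
      have h3 : ‖e.symm y‖ ≤ ‖y‖ / c := by rw [le_div_iff₀ hc]; linarith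
      calc _ ≤ _ := h1
        _ ≤ ‖A - B‖ * (‖y‖ / c) := by gcongr
        _ = _ := by ring
    refine this.trans_lt ?_
    rwa [div_lt_one hc]
  obtain ⟨u, hu⟩ := isUnit_one_sub_of_norm_lt_one hR
  intro y
  refine ⟨e.symm ((↑u⁻¹ : F →L[ℂ] F) y), ?_⟩
  have h := congrArg (fun L : F →L[ℂ] F => L y) u.mul_inv
  rw [hu] at h
  set z := (↑u⁻¹ : F →L[ℂ] F) y
  have h' : z - (B (e.symm z) - A (e.symm z)) = y := h
  rw [← he, e.apply_symm_apply] at h'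
  rw [← h']; abel

theorem aux_pyth {H : Type*} [NormedAddCommGroup H] [InnerProductSpace ℂ H] (x y : H) (s : ℂ)
    (hs : s = Complex.I ∨ s = -Complex.I) (hsym : inner ℂ y x = inner ℂ x y) :
    ‖y + s • x‖ ^ 2 = ‖y‖ ^ 2 + ‖x‖ ^ 2 := by
  have him : (inner ℂ y x).im = 0 := by
    have := inner_conj_symm (𝕜 := ℂ) x y
    rw [hsym] at this ⊢
    exact Complex.conj_eq_iff_im.1 (by rw [← hsym] at this ⊢; rw [← this]; simp [hsym])
  rw [@norm_add_sq ℂ]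
  rcases hs with rfl | rfl <;> simp [inner_smul_right, norm_smul, him]

theorem aux_sa {H : Type*} [NormedAddCommGroup H] [InnerProductSpace ℂ H] [CompleteSpace H]
    (A : H →ₗ.[ℂ] H) (hd : Dense (A.domain : Set H)) (hsym : A.IsFormalAdjoint A)
    (hp : ∀ s : ℂ, (s = Complex.I ∨ s = -Complex.I) → ∀ y, ∃ x : A.domain, A x + s • (x : H) = y) :
    IsSelfAdjoint A := by
  rw [LinearPMap.isSelfAdjoint_def]
  symm
  have hle := LinearPMap.IsFormalAdjoint.le_adjoint hd hsym
  refine LinearPMap.eq_of_le_of_domain_eq hle (le_antisymm hle.1 ?_)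
  intro y hy
  obtain ⟨x, hx⟩ := hp (-Complex.I) (Or.inr rfl) (A.adjoint ⟨y, hy⟩ + (-Complex.I) • y)
  have key : y - x = 0 := by
    obtain ⟨z, hz⟩ := hp Complex.I (Or.inl rfl) (y - x)
    have h1 := LinearPMap.adjoint_isFormalAdjoint hd ⟨y, hy⟩ z
    have h2 := hsym x z
    rw [← inner_self_eq_zero (𝕜 := ℂ)]
    nth_rewrite 2 [← hz]
    have h3 : A.adjoint ⟨y, hy⟩ - A x = Complex.I • (y - x) := by
      rw [neg_smul, neg_smul] at hx
      rw [smul_sub, sub_eq_sub_iff_add_eq_add, ← sub_eq_zero]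
      rw [← sub_eq_zero] at hx
      rw [← neg_eq_zero, ← hx]; abel
    have h4 : inner ℂ (A.adjoint ⟨y, hy⟩ - A x) (z : H) = inner ℂ (y - x) (A z) := by
      rw [inner_sub_left, inner_sub_left, h1, h2]
    rw [inner_add_right, ← h4, h3, inner_smul_left, inner_smul_right]
    simp
  rw [sub_eq_zero] at key
  rw [key]; exact x.2

theorem aux_surj0 {H : Type*} [NormedAddCommGroup H] [InnerProductSpace ℂ H] [CompleteSpace H]
    (A : H →ₗ.[ℂ] H) (hA : IsSelfAdjoint A) (R : Submodule ℂ H) (hR : IsClosed (R : Set H))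
    (s : ℂ) (hs : s = Complex.I ∨ s = -Complex.I)
    (hr : ∀ x : A.domain, A x + s • (x : H) ∈ R) : R = ⊤ := by
  have hd := hA.dense_domain
  rw [LinearPMap.isSelfAdjoint_def] at hA
  have : CompleteSpace R := hR.completeSpace_coe
  rw [← Submodule.orthogonal_eq_bot_iff, Submodule.eq_bot_iff]
  intro y hy
  rw [Submodule.mem_orthogonal'] at hy
  have h0 : ∀ x : A.domain, inner ℂ (-(star s) • y) (x : H) = inner ℂ y (A x) := by
    intro x
    have := hy _ (hr x)
    rw [inner_add_right, inner_smul_right] at this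
    rw [inner_smul_left]
    simp
    linear_combination -this
  have hm : y ∈ A.adjoint.domain := LinearPMap.mem_adjoint_domain_of_exists _ ⟨_, h0⟩
  have hmA : y ∈ A.domain := by rwa [hA] at hm
  have hF : A.IsFormalAdjoint A := by
    have := LinearPMap.adjoint_isFormalAdjoint hd
    rwa [hA] at this
  have h3 := hy _ (hr ⟨y, hmA⟩)
  have h5 := hF ⟨y, hmA⟩ ⟨y, hmA⟩
  have him : (inner ℂ y (A ⟨y, hmA⟩)).im = 0 := by
    have := inner_conj_symm (𝕜 := ℂ) y (A ⟨y, hmA⟩)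
    rw [h5] at this
    exact Complex.conj_eq_iff_im.1 this
  rw [inner_add_right, inner_smul_right, inner_self_eq_norm_sq_to_K] at h3
  have h6 := congrArg Complex.im h3
  rw [Complex.add_im, him] at h6
  rcases hs with rfl | rfl <;> simpa [← Complex.ofReal_pow] using h6

theorem aux_cont {E F : Type*} [NormedAddCommGroup E] [NormedSpace ℂ E]
    [NormedAddCommGroup F] [NormedSpace ℂ F] (q B1 B2 r : E →L[ℂ] F) (κ c : ℝ) (hc : 0 < c) :
    ∀ᶠ κ' : ℝ in 𝓝 κ, ‖(q + (κ' : ℂ) • B1 + (κ' : ℂ) ^ 2 • B2 + r) -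
      (q + (κ : ℂ) • B1 + (κ : ℂ) ^ 2 • B2 + r)‖ < c := by
  have h : Continuous fun κ' : ℝ => ‖(q + (κ' : ℂ) • B1 + (κ' : ℂ) ^ 2 • B2 + r) -
      (q + (κ : ℂ) • B1 + (κ : ℂ) ^ 2 • B2 + r)‖ := by fun_prop
  have h2 := h.tendsto κ
  rw [sub_self, norm_zero] at h2
  exact h2.eventually_lt_const hc

theorem aux_B {H : Type*} [NormedAddCommGroup H] [InnerProductSpace ℂ H]
    (T T1 : H →ₗ.[ℂ] H) (h1 : T.domain ≤ T1.domain)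
    (hb1 : ∃ a b : ℝ, 0 ≤ a ∧ 0 ≤ b ∧
      ∀ x : T.domain, ‖T1 ⟨(x : H), h1 x.2⟩‖ ≤ a * ‖(x : H)‖ + b * ‖T x‖) :
    ∃ B : T.graph →L[ℂ] H, ∀ x : T.domain, B ⟨_, T.mem_graph x⟩ = T1 ⟨(x : H), h1 x.2⟩ := by
  obtain ⟨a, b, ha, hb, h⟩ := hb1
  have hdom : ∀ g : T.graph, (g : H × H).1 ∈ T.domain := fun g =>
    LinearPMap.mem_domain_of_mem_graph g.2
  let P : T.graph →ₗ[ℂ] T.domain :=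
    LinearMap.codRestrict _ (LinearMap.fst ℂ H H ∘ₗ T.graph.subtype) hdom
  refine ⟨LinearMap.mkContinuous (T1.toFun ∘ₗ Submodule.inclusion h1 ∘ₗ P) (a + b) ?_, ?_⟩
  · rintro ⟨g, hg⟩
    obtain ⟨x, hx⟩ := (LinearPMap.mem_graph_iff _).1 hg
    obtain ⟨g1, g2⟩ := g
    obtain ⟨rfl, rfl⟩ := hx
    refine (h x).trans ?_
    have e1 : ‖(x : H)‖ ≤ ‖((x : H), T x)‖ := norm_fst_le ((x : H), T x)
    have e2 : ‖T x‖ ≤ ‖((x : H), T x)‖ := norm_snd_le ((x : H), T x)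
    change _ ≤ (a + b) * ‖((x : H), T x)‖
    rw [add_mul]
    gcongr
  · intro x
    rfl

theorem pertOp_isSelfAdjoint {H : Type*} [NormedAddCommGroup H] [InnerProductSpace ℂ H]
    [CompleteSpace H]
    (T T1 T2 : H →ₗ.[ℂ] H)
    (h1 : T.domain ≤ T1.domain) (h2 : T.domain ≤ T2.domain)
    (hdense : Dense (T.domain : Set H))
    (hTsa : IsSelfAdjoint T)
    (hsym1 : T1.IsFormalAdjoint T1) (hsym2 : T2.IsFormalAdjoint T2)
    (hb1 : ∃ a b : ℝ, 0 ≤ a ∧ 0 ≤ b ∧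
      ∀ x : T.domain, ‖T1 ⟨(x : H), h1 x.2⟩‖ ≤ a * ‖(x : H)‖ + b * ‖T x‖)
    (hb2 : ∃ a b : ℝ, 0 ≤ a ∧ 0 ≤ b ∧
      ∀ x : T.domain, ‖T2 ⟨(x : H), h2 x.2⟩‖ ≤ a * ‖(x : H)‖ + b * ‖T x‖)
    (t : ℝ) (ht : 0 ≤ t)
    (hclosed : ∀ κ : ℝ, κ ∈ Set.Icc 0 t → (pertOp T T1 T2 h1 h2 (κ : ℂ)).IsClosed) :
    IsSelfAdjoint (pertOp T T1 T2 h1 h2 (t : ℂ)) := by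
  obtain ⟨B1, hB1⟩ := aux_B T T1 h1 hb1
  obtain ⟨B2, hB2⟩ := aux_B T T2 h2 hb2
  have hTc : _root_.IsClosed (T.graph : Set (H × H)) := hTsa.isClosed
  have : CompleteSpace T.graph := hTc.completeSpace_coe
  have hT : T.IsFormalAdjoint T := by
    have := LinearPMap.adjoint_isFormalAdjoint hdense
    rwa [LinearPMap.isSelfAdjoint_def.1 hTsa] at this
  have happ : ∀ (κ : ℂ) (x : T.domain), pertOp T T1 T2 h1 h2 κ x =
      T x + κ • T1 ⟨(x : H), h1 x.2⟩ + κ ^ 2 • T2 ⟨(x : H), h2 x.2⟩ := fun κ x => rfl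
  have hsym : ∀ κ : ℝ, (pertOp T T1 T2 h1 h2 κ).IsFormalAdjoint (pertOp T T1 T2 h1 h2 κ) := by
    intro κ x' y'
    let x : T.domain := x'
    let y : T.domain := y'
    have e := hT x y
    have e1 := hsym1 ⟨(x : H), h1 x.2⟩ ⟨(y : H), h1 y.2⟩
    have e2 := hsym2 ⟨(x : H), h2 x.2⟩ ⟨(y : H), h2 y.2⟩
    change inner ℂ (pertOp T T1 T2 h1 h2 κ x) (y : H) = inner ℂ (x : H) (pertOp T T1 T2 h1 h2 κ y)
    rw [happ, happ]
    simp only [inner_add_left, inner_add_right, inner_smul_left, inner_smul_right, map_pow,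
      Complex.conj_ofReal]
    rw [e, e1, e2]
  let p : T.graph →L[ℂ] H := ContinuousLinearMap.fst ℂ H H ∘L T.graph.subtypeL
  let q : T.graph →L[ℂ] H := ContinuousLinearMap.snd ℂ H H ∘L T.graph.subtypeL
  let Q : ℝ → (T.graph →L[ℂ] H) := fun κ => q + (κ : ℂ) • B1 + (κ : ℂ) ^ 2 • B2
  have hQ : ∀ (κ : ℝ) (x : T.domain), Q κ ⟨_, T.mem_graph x⟩ = pertOp T T1 T2 h1 h2 κ x := by
    intro κ x
    rw [happ, ← hB1, ← hB2]
    rfl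
  have hp : ∀ (x : T.domain), p ⟨_, T.mem_graph x⟩ = x := fun x => rfl
  have hrep : ∀ g : T.graph, ∃ x : T.domain, g = ⟨_, T.mem_graph x⟩ := by
    rintro ⟨⟨g1, g2⟩, hg⟩
    obtain ⟨x, hx⟩ := (LinearPMap.mem_graph_iff _).1 hg
    exact ⟨x, Subtype.ext (Prod.ext hx.1.symm hx.2.symm)⟩
  have hbb : ∀ κ ∈ Set.Icc 0 t, ∃ c > 0, ∀ s : ℂ, (s = Complex.I ∨ s = -Complex.I) →
      ∀ g, c * ‖g‖ ≤ ‖(Q κ + s • p) g‖ := by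
    intro κ hκ
    have hr : Set.range ((p.prod (Q κ) : T.graph →L[ℂ] H × H)) =
        ((pertOp T T1 T2 h1 h2 (κ : ℂ)).graph : Set (H × H)) := by
      ext ⟨u, v⟩
      constructor
      · rintro ⟨g, hg⟩
        obtain ⟨x, rfl⟩ := hrep g
        rw [← hg, ContinuousLinearMap.prod_apply, hQ, hp]
        exact (pertOp T T1 T2 h1 h2 (κ : ℂ)).mem_graph x
      · intro hg
        obtain ⟨x', hx⟩ := (LinearPMap.mem_graph_iff _).1 hg
        let x : T.domain := x'
        refine ⟨⟨_, T.mem_graph x⟩, ?_⟩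
        rw [ContinuousLinearMap.prod_apply, hQ, hp]
        exact Prod.ext hx.1 hx.2
    have hinj : Function.Injective (p.prod (Q κ) : T.graph →L[ℂ] H × H) := by
      intro g g' h
      obtain ⟨x, rfl⟩ := hrep g
      obtain ⟨y, rfl⟩ := hrep g'
      have := congrArg Prod.fst h
      have hxy : x = y := Subtype.ext this
      rw [hxy]
    obtain ⟨K, hK⟩ := ContinuousLinearMap.antilipschitz_of_injective_of_isClosed_range
      (p.prod (Q κ)) hinj (hr ▸ hclosed κ hκ)
    refine ⟨((K : ℝ) + 1)⁻¹, by positivity, fun s hs g => ?_⟩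
    rw [inv_mul_le_iff₀ (by positivity)]
    have hn := (p.prod (Q κ)).bound_of_antilipschitz hK g
    obtain ⟨x, rfl⟩ := hrep g
    have hpy := aux_pyth (x : H) (pertOp T T1 T2 h1 h2 (κ : ℂ) x) s hs (hsym κ x x)
    set g : T.graph := ⟨_, T.mem_graph x⟩
    have hA : (Q κ + s • p) g = pertOp T T1 T2 h1 h2 (κ : ℂ) x + s • (x : H) := by
      rw [← hQ]; rfl
    rw [hA]
    have hle : ‖(p.prod (Q κ)) g‖ ≤ ‖pertOp T T1 T2 h1 h2 (κ : ℂ) x + s • (x : H)‖ := by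
      rw [ContinuousLinearMap.prod_apply, hQ, hp, Prod.norm_def]
      refine max_le ?_ ?_ <;> refine abs_le_of_sq_le_sq' ?_ (norm_nonneg _) |>.2 <;>
        rw [hpy] <;> simp
    have := norm_nonneg (pertOp T T1 T2 h1 h2 (κ : ℂ) x + s • (x : H))
    have hK0 : (0 : ℝ) ≤ K := K.2
    nlinarith [mul_le_mul_of_nonneg_left hle hK0]
  refine aux_sa _ hdense (hsym t) fun s hs => ?_
  suffices hsurj : Function.Surjective (Q t + s • p) by
    intro y
    obtain ⟨g, hg⟩ := hsurj y
    obtain ⟨x, rfl⟩ := hrep g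
    refine ⟨x, ?_⟩
    rw [← hg, ← hQ]; rfl
  have h0mem : (0 : ℝ) ∈ Set.Icc 0 t := ⟨le_rfl, ht⟩
  have h0 : Function.Surjective (Q 0 + s • p) := by
    obtain ⟨c, hc, hcb⟩ := hbb 0 h0mem
    have hanti : AntilipschitzWith (Real.toNNReal c⁻¹) (Q 0 + s • p) := by
      refine AddMonoidHomClass.antilipschitz_of_bound _ fun g => ?_
      rw [Real.coe_toNNReal _ (by positivity), ← div_eq_inv_mul, le_div_iff₀ hc, mul_comm]
      exact hcb s hs g
    have hcl := hanti.isClosed_range (Q 0 + s • p).uniformContinuous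
    refine LinearMap.range_eq_top.1 (aux_surj0 T hTsa (LinearMap.range (Q 0 + s • p).toLinearMap)
      ?_ s hs ?_)
    · exact hcl
    · intro x
      refine ⟨⟨_, T.mem_graph x⟩, ?_⟩
      change Q 0 ⟨_, T.mem_graph x⟩ + s • (x : H) = _
      rw [hQ, happ]; simp
  refine isPreconnected_Icc.induction₂'
    (fun κ κ' => Function.Surjective (Q κ + s • p) → Function.Surjective (Q κ' + s • p))
    ?_ (fun _ _ _ _ _ _ h h' => h' ∘ h) h0mem ⟨ht, le_rfl⟩ h0
  intro κ hκ
  obtain ⟨c, hc, hcb⟩ := hbb κ hκ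
  have hev : ∀ᶠ κ' in 𝓝[Set.Icc 0 t] κ, ‖(Q κ' + s • p) - (Q κ + s • p)‖ < c / 2 := by
    exact nhdsWithin_le_nhds (aux_cont q B1 B2 (s • p) κ (c / 2) (by positivity))
  filter_upwards [hev] with κ' hκ'
  refine ⟨fun h => aux_surj _ _ c hc (hcb s hs) h (by linarith), fun h => ?_⟩
  refine aux_surj _ _ (c / 2) (by positivity) (fun g => ?_) h (by rwa [norm_sub_rev])
  have e1 := hcb s hs g
  have e2 := ((Q κ' + s • p) - (Q κ + s • p)).le_of_opNorm_le hκ'.le g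
  have e3 : ‖(Q κ + s • p) g‖ ≤ ‖(Q κ' + s • p) g‖ +
      ‖((Q κ' + s • p) - (Q κ + s • p)) g‖ := by
    rw [_root_.sub_apply]
    have := norm_sub_le ((Q κ' + s • p) g) ((Q κ' + s • p) g - (Q κ + s • p) g)
    rwa [sub_sub_cancel] at this
  linarith
end

section
/- Let H be a complex Hilbert space, let T be a densely defined self-adjoint operator on H, and let T¹ and T² be symmetric operators whose domains contain D(T) and which are T-bounded, i.e. for j = 1,2 there exist constants a_j, b_j ≥ 0 such that ‖T^{(j)}x‖ ≤ a_j‖x‖ + b_j‖Tx‖ for all x ∈ D(T). For κ ∈ ℂ let T(κ) = T + κT¹ + κ²T² with domain D(T). If T(κ₀) is closed for some κ₀ ∈ ℂ, then there exists ε > 0 such that T(κ) is closed for every κ ∈ ℂ with |κ − κ₀| < ε. In other words, the set Z = {κ ∈ ℂ : T(κ) is closed} is open. -/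
open LinearPMap

theorem quad_cont {V : Type*} [NormedAddCommGroup V] [NormedSpace ℂ V] (C0 C1 C2 : V) (k0 : ℂ)
    (δ : ℝ) (hδ : 0 < δ) : ∃ ε > 0, ∀ k : ℂ, ‖k - k0‖ < ε →
      ‖(C0 + k • C1 + k ^ 2 • C2) - (C0 + k0 • C1 + k0 ^ 2 • C2)‖ < δ := by
  have hB : Continuous fun k : ℂ => C0 + k • C1 + k ^ 2 • C2 := by fun_prop
  obtain ⟨ε, hε, h⟩ := Metric.continuousAt_iff.1 (hB.continuousAt (x := k0)) δ hδ
  refine ⟨ε, hε, fun k hk => ?_⟩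
  have := h (x := k) (by rwa [dist_eq_norm])
  rwa [dist_eq_norm] at this

/-- projection of the graph to the domain -/
noncomputable def graphToDom {H : Type*} [NormedAddCommGroup H] [InnerProductSpace ℂ H]
    (T : H →ₗ.[ℂ] H) : T.graph →ₗ[ℂ] T.domain :=
  LinearMap.codRestrict T.domain ((LinearMap.fst ℂ H H) ∘ₗ T.graph.subtype)
    (fun z => T.mem_domain_of_mem_graph (x := z.1.1) (y := z.1.2) z.2)

theorem graphToDom_apply {H : Type*} [NormedAddCommGroup H] [InnerProductSpace ℂ H]
    (T : H →ₗ.[ℂ] H) (z : T.graph) : T (graphToDom T z) = z.1.2 := by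
  obtain ⟨y, hy1, hy2⟩ := (LinearPMap.mem_graph_iff T).1 z.2
  have : graphToDom T z = y := Subtype.ext hy1.symm
  rw [this, hy2]

theorem exists_clm {H : Type*} [NormedAddCommGroup H] [InnerProductSpace ℂ H]
    (T S : H →ₗ.[ℂ] H) (h : T.domain ≤ S.domain)
    (hb : ∃ a b : ℝ, 0 ≤ a ∧ 0 ≤ b ∧
      ∀ x : T.domain, ‖S ⟨(x : H), h x.2⟩‖ ≤ a * ‖(x : H)‖ + b * ‖T x‖) :
    ∃ A : T.graph →L[ℂ] H, ∀ z, A z = S.toFun (Submodule.inclusion h (graphToDom T z)) := by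
  obtain ⟨a, b, ha, hb, hab⟩ := hb
  refine ⟨LinearMap.mkContinuous (S.toFun ∘ₗ Submodule.inclusion h ∘ₗ graphToDom T) (a + b) ?_,
    fun z => rfl⟩
  intro z
  have h0 := hab (graphToDom T z)
  rw [graphToDom_apply] at h0
  have e1 : ‖((graphToDom T z : T.domain) : H)‖ ≤ ‖z‖ := norm_fst_le z.1
  have e2 : ‖z.1.2‖ ≤ ‖z‖ := norm_snd_le z.1
  refine le_trans h0 ?_
  rw [add_mul]
  gcongr

/-- If `T` is a densely defined self-adjoint operator and `T¹, T²` are symmetric `T`-bounded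
operators defined on `D(T)`, then the set `Z = {κ ∈ ℂ : T(κ) is closed}` is open: if
`T(κ₀)` is closed, then `T(κ)` is closed for all `κ` close enough to `κ₀`. -/
theorem pertOp_isClosed_isOpen {H : Type*} [NormedAddCommGroup H] [InnerProductSpace ℂ H]
    [CompleteSpace H]
    (T T1 T2 : H →ₗ.[ℂ] H)
    (h1 : T.domain ≤ T1.domain) (h2 : T.domain ≤ T2.domain)
    (hdense : Dense (T.domain : Set H))
    (hTsa : IsSelfAdjoint T)
    (hsym1 : T1.IsFormalAdjoint T1) (hsym2 : T2.IsFormalAdjoint T2)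
    (hb1 : ∃ a b : ℝ, 0 ≤ a ∧ 0 ≤ b ∧
      ∀ x : T.domain, ‖T1 ⟨(x : H), h1 x.2⟩‖ ≤ a * ‖(x : H)‖ + b * ‖T x‖)
    (hb2 : ∃ a b : ℝ, 0 ≤ a ∧ 0 ≤ b ∧
      ∀ x : T.domain, ‖T2 ⟨(x : H), h2 x.2⟩‖ ≤ a * ‖(x : H)‖ + b * ‖T x‖)
    (κ₀ : ℂ) (hκ₀ : (pertOp T T1 T2 h1 h2 κ₀).IsClosed) :
    ∃ ε > 0, ∀ κ : ℂ, ‖κ - κ₀‖ < ε → (pertOp T T1 T2 h1 h2 κ).IsClosed := by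
  have hTc : T.IsClosed := hTsa.isClosed
  have : CompleteSpace T.graph := _root_.IsClosed.completeSpace_coe (hs := hTc)
  obtain ⟨A1, hA1⟩ := exists_clm T T1 h1 hb1
  obtain ⟨A2, hA2⟩ := exists_clm T T2 h2 hb2
  let B : ℂ → (T.graph →L[ℂ] H × H) := fun κ =>
    T.graph.subtypeL + κ • ((ContinuousLinearMap.inr ℂ H H).comp A1)
      + κ ^ 2 • ((ContinuousLinearMap.inr ℂ H H).comp A2)
  have hB1 : ∀ κ z, (B κ z).1 = (graphToDom T z : H) := by
    intro κ z
    simp [B]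
    rfl
  have hB2 : ∀ κ z, (B κ z).2 = (pertOp T T1 T2 h1 h2 κ).toFun (graphToDom T z) := by
    intro κ z
    have := graphToDom_apply T z
    change (B κ z).2 = T (graphToDom T z)
      + κ • T1.toFun (Submodule.inclusion h1 (graphToDom T z))
      + κ ^ 2 • T2.toFun (Submodule.inclusion h2 (graphToDom T z))
    rw [← hA1, ← hA2, this]
    simp [B]
  have hinj : ∀ κ, Function.Injective (B κ) := by
    intro κ z w hzw
    have e : graphToDom T z = graphToDom T w := by
      apply Subtype.ext
      rw [← hB1 κ, ← hB1 κ, hzw]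
    apply Subtype.ext
    apply Prod.ext
    · exact congrArg Subtype.val e
    · rw [← graphToDom_apply, ← graphToDom_apply, e]
  have hrange : ∀ κ, Set.range (B κ) = ((pertOp T T1 T2 h1 h2 κ).graph : Set (H × H)) := by
    intro κ
    ext p
    rw [SetLike.mem_coe, LinearPMap.mem_graph_iff]
    constructor
    · rintro ⟨z, rfl⟩
      exact ⟨graphToDom T z, (hB1 κ z).symm, (hB2 κ z).symm⟩
    · rintro ⟨y, hy1, hy2⟩
      let y' : T.domain := y
      refine ⟨⟨((y' : H), T y'), T.mem_graph y'⟩, Prod.ext ?_ ?_⟩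
      · rw [hB1, ← hy1]; rfl
      · rw [hB2, ← hy2]; rfl
  obtain ⟨K, hK⟩ := (B κ₀).isClosed_range_iff_antilipschitz_of_injective (hinj κ₀) |>.1
    (by rw [hrange]; exact hκ₀)
  have hδ : (0 : ℝ) < 1 / (2 * (K + 1)) := by positivity
  obtain ⟨ε, hε, hball⟩ := quad_cont T.graph.subtypeL
    ((ContinuousLinearMap.inr ℂ H H).comp A1) ((ContinuousLinearMap.inr ℂ H H).comp A2) κ₀ _ hδ
  refine ⟨ε, hε, fun κ hκ => ?_⟩
  have hd : ‖B κ - B κ₀‖ < 1 / (2 * ((K : ℝ) + 1)) := hball κ hκ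
  change _root_.IsClosed _
  rw [← hrange]
  have key : ∀ z, ‖z‖ ≤ ((2 * K : NNReal) : ℝ) * ‖B κ z‖ := by
    intro z
    have k1 : ‖z‖ ≤ K * ‖B κ₀ z‖ := ZeroHomClass.bound_of_antilipschitz (B κ₀) hK z
    have k2 : ‖(B κ - B κ₀) z‖ ≤ 1 / (2 * (K + 1)) * ‖z‖ :=
      ((B κ - B κ₀).le_opNorm z).trans (by gcongr)
    have k3 : ‖B κ₀ z‖ ≤ ‖B κ z‖ + ‖(B κ - B κ₀) z‖ := by
      have := norm_sub_le (B κ z) ((B κ - B κ₀) z)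
      simpa using this
    have k4 : (K : ℝ) * (1 / (2 * (K + 1))) ≤ 1 / 2 := by
      rw [mul_one_div, div_le_div_iff₀ (by positivity) (by norm_num)]
      linarith
    have k5 : (K : ℝ) * ‖B κ₀ z‖ ≤ K * ‖B κ z‖ + K * (1 / (2 * (K + 1)) * ‖z‖) := by
      rw [← mul_add]
      exact mul_le_mul_of_nonneg_left (k3.trans (by gcongr)) K.2
    have k6 := mul_le_mul_of_nonneg_right k4 (norm_nonneg z)
    push_cast
    nlinarith
  exact (B κ).isClosed_range_iff_antilipschitz_of_injective (hinj κ) |>.2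
    ⟨2 * K, (B κ).antilipschitz_of_bound key⟩
end

section
/- Let E : ℝ³ → ℝ satisfy: (i) E(0) ≤ E(ξ) for all ξ ∈ ℝ³; (ii) E(−ξ) = E(ξ) for all ξ ∈ ℝ³; (iii) the function ξ ↦ ½|ξ|² − E(ξ) is convex on ℝ³. Then for every m > 0 and every ξ ∈ ℝ³ with |ξ| ≤ 1 there exists a constant c > 0 such that E(ξ − k) − E(ξ) + √(m² + |k|²) ≥ c for all k ∈ ℝ³. -/
/-- If `E : ℝ³ → ℝ` attains its minimum at `0`, is even, and `ξ ↦ ½‖ξ‖² - E(ξ)` is convex,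
then for every photon mass `m > 0` and every `ξ` with `‖ξ‖ ≤ 1` the gap
`Δ_m(ξ) = inf_k { E(ξ-k) - E(ξ) + √(m² + ‖k‖²) }` is positive. -/
theorem gap_positive (E : EuclideanSpace ℝ (Fin 3) → ℝ)
    (h1 : ∀ ξ, E 0 ≤ E ξ)
    (h2 : ∀ ξ, E (-ξ) = E ξ)
    (h3 : ConvexOn ℝ Set.univ (fun ξ : EuclideanSpace ℝ (Fin 3) => (1 / 2) * ‖ξ‖ ^ 2 - E ξ))
    (m : ℝ) (hm : 0 < m) (ξ : EuclideanSpace ℝ (Fin 3)) (hξ : ‖ξ‖ ≤ 1) :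
    ∃ c > 0, ∀ k : EuclideanSpace ℝ (Fin 3),
      c ≤ E (ξ - k) - E ξ + Real.sqrt (m ^ 2 + ‖k‖ ^ 2) := by
  have hE : E ξ ≤ E 0 + 1 / 2 := by
    have h := h3.2 (Set.mem_univ ξ) (Set.mem_univ (-ξ)) (by norm_num : (0 : ℝ) ≤ 1 / 2)
      (by norm_num : (0 : ℝ) ≤ 1 / 2) (by norm_num)
    have h0 : (1 / 2 : ℝ) • ξ + (1 / 2 : ℝ) • (-ξ) = 0 := by simp
    rw [h0] at h
    simp only [norm_neg, norm_zero, h2, smul_eq_mul] at h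
    nlinarith [norm_nonneg ξ]
  have key : ∀ k : EuclideanSpace ℝ (Fin 3), ‖k‖ ≤ 1 → E ξ - E (ξ - k) ≤ ‖k‖ := by
    intro k hk
    by_cases hk0 : k = 0
    · simp [hk0]
    have hr : 0 < ‖k‖ := norm_pos_iff.mpr hk0
    obtain ⟨n, hn, hkn⟩ : ∃ n : EuclideanSpace ℝ (Fin 3), ‖n‖ = 1 ∧ k = ‖k‖ • n := by
      refine ⟨‖k‖⁻¹ • k, ?_, ?_⟩
      · rw [norm_smul, norm_inv, norm_norm, inv_mul_cancel₀ hr.ne']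
      · rw [smul_smul, mul_inv_cancel₀ hr.ne', one_smul]
    generalize ‖k‖ = r at *
    subst hkn
    have h := h3.2 (Set.mem_univ ξ) (Set.mem_univ (ξ - n)) (by linarith : (0 : ℝ) ≤ 1 - r)
      hr.le (by ring)
    have h0 : (1 - r) • ξ + r • (ξ - n) = ξ - r • n := by module
    rw [h0] at h
    simp only [smul_eq_mul, norm_sub_sq_real, inner_smul_right, norm_smul, hn, mul_one,
      Real.norm_eq_abs, sq_abs] at h
    nlinarith [h1 (ξ - n)]
  have hs : 0 < Real.sqrt (m ^ 2 + 1) + 1 := by positivity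
  refine ⟨min (1 / 2) (m ^ 2 / (Real.sqrt (m ^ 2 + 1) + 1)), by positivity, fun k => ?_⟩
  rcases le_total ‖k‖ 1 with hk | hk
  · refine (min_le_right _ _).trans ?_
    have := key k hk
    have hle : Real.sqrt (m ^ 2 + ‖k‖ ^ 2) ≤ Real.sqrt (m ^ 2 + 1) :=
      Real.sqrt_le_sqrt (by nlinarith [norm_nonneg k])
    have hsq := Real.sq_sqrt (by positivity : (0 : ℝ) ≤ m ^ 2 + ‖k‖ ^ 2)
    have hge : ‖k‖ ≤ Real.sqrt (m ^ 2 + ‖k‖ ^ 2) := Real.le_sqrt_of_sq_le (by nlinarith)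
    have : m ^ 2 / (Real.sqrt (m ^ 2 + 1) + 1) ≤ Real.sqrt (m ^ 2 + ‖k‖ ^ 2) - ‖k‖ := by
      rw [div_le_iff₀ hs]
      nlinarith
    linarith
  · refine (min_le_left _ _).trans ?_
    have hge : 1 ≤ Real.sqrt (m ^ 2 + ‖k‖ ^ 2) := Real.le_sqrt_of_sq_le (by nlinarith)
    linarith [h1 (ξ - k)]
end

section
/- Let E : ℝ³ → ℝ satisfy: (i) E(0) ≤ E(ξ) for all ξ ∈ ℝ³; (ii) E(ξ) ≤ ½|ξ|² + E(0) for all ξ ∈ ℝ³; (iii) the function ξ ↦ ½|ξ|² − E(ξ) is convex on ℝ³. Then for all ξ, k ∈ ℝ³: if |k| ≤ |ξ| then E(ξ − k) − E(ξ) ≥ −|k||ξ| + ½|k|², and if |k| ≥ |ξ| then E(ξ − k) − E(ξ) ≥ −½|ξ|². -/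
/-- If `E : ℝ³ → ℝ` attains its minimum at `0`, satisfies `E(ξ) ≤ ½‖ξ‖² + E(0)`, and
`ξ ↦ ½‖ξ‖² - E(ξ)` is convex, then `E(ξ-k) - E(ξ) ≥ -‖k‖‖ξ‖ + ½‖k‖²` for `‖k‖ ≤ ‖ξ‖` and
`E(ξ-k) - E(ξ) ≥ -½‖ξ‖²` for `‖k‖ ≥ ‖ξ‖`. -/
theorem energy_lower_bound (E : EuclideanSpace ℝ (Fin 3) → ℝ)
    (h1 : ∀ ξ, E 0 ≤ E ξ)
    (h2 : ∀ ξ, E ξ ≤ (1 / 2) * ‖ξ‖ ^ 2 + E 0)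
    (h3 : ConvexOn ℝ Set.univ (fun ξ : EuclideanSpace ℝ (Fin 3) => (1 / 2) * ‖ξ‖ ^ 2 - E ξ))
    (ξ k : EuclideanSpace ℝ (Fin 3)) :
    (‖k‖ ≤ ‖ξ‖ → -‖k‖ * ‖ξ‖ + (1 / 2) * ‖k‖ ^ 2 ≤ E (ξ - k) - E ξ) ∧
    (‖ξ‖ ≤ ‖k‖ → -(1 / 2) * ‖ξ‖ ^ 2 ≤ E (ξ - k) - E ξ) := by
  refine ⟨fun hk => ?_, fun _ => ?_⟩
  · by_cases hk0 : k = 0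
    · subst hk0
      simp
    have ha : 0 < ‖k‖ := norm_pos_iff.mpr hk0
    have hb : 0 < ‖ξ‖ := lt_of_lt_of_le ha hk
    obtain ⟨s, hs⟩ : ∃ s, s = ‖k‖ / ‖ξ‖ := ⟨_, rfl⟩
    have hs0 : 0 < s := by rw [hs]; positivity
    have hs1 : s ≤ 1 := by rw [hs]; exact (div_le_one hb).mpr hk
    have hsb : ‖k‖ = s * ‖ξ‖ := by rw [hs]; field_simp
    have hconv := h3.2 (Set.mem_univ ξ) (Set.mem_univ (ξ - s⁻¹ • k))
      (sub_nonneg.mpr hs1) hs0.le (by ring)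
    have hpt : (1 - s) • ξ + s • (ξ - s⁻¹ • k) = ξ - k := by
      rw [smul_sub, smul_smul, mul_inv_cancel₀ hs0.ne', sub_smul, one_smul, one_smul]
      abel
    rw [hpt] at hconv
    simp only [smul_eq_mul] at hconv
    have e1 := norm_sub_sq_real ξ k
    have e2 := norm_sub_sq_real ξ (s⁻¹ • k)
    rw [inner_smul_right, norm_smul, Real.norm_of_nonneg (inv_nonneg.mpr hs0.le), hsb] at e2
    have e3 : s * ‖ξ - s⁻¹ • k‖ ^ 2 = 2 * s * ‖ξ‖ ^ 2 - 2 * inner ℝ ξ k := by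
      rw [e2]; field_simp; ring
    have g1 := mul_le_mul_of_nonneg_left (h1 (ξ - s⁻¹ • k)) hs0.le
    have g2 := mul_le_mul_of_nonneg_left (h2 ξ) hs0.le
    have e4 : ‖k‖ * ‖ξ‖ = s * ‖ξ‖ ^ 2 := by rw [hsb]; ring
    nlinarith
  · have := h1 (ξ - k)
    have := h2 ξ
    linarith
end

section
/- Let Λ > 0. There exist δ > 0 and a constant C < ∞, depending only on Λ, with the following property. Let H be a complex Hilbert space, A ≥ 0, and let F : ℝ³ → H be a measurable function such that: F(k) = 0 for almost every k with |k| ≥ Λ; ‖F(k)‖ ≤ A/|k| for almost every k; and F is continuously differentiable on the open set U = {k ∈ ℝ³ : 0 < |k| < Λ, k₁² + k₂² > 0} with ‖F′(k)‖ ≤ A/(|k| √(k₁² + k₂²)) for every k ∈ U. Then for every a ∈ ℝ³ with 0 < |a| ≤ Λ/2 one has ∫_{ℝ³} ‖F(k + a) − F(k)‖² dk ≤ C A² |a|^δ. -/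
open MeasureTheory
open scoped ENNReal

lemma aux_pi {n : ℕ} (f : Fin n → ℝ → ℝ≥0∞) (hf : ∀ i, Measurable (f i)) :
    ∫⁻ x : Fin n → ℝ, ∏ i, f i (x i) = ∏ i, ∫⁻ x, f i x := by
  induction n with
  | zero => simp [volume_pi]
  | succ n ih =>
    rw [Fin.prod_univ_succ, ← ih (fun i => f i.succ) (fun i => hf _), 
      ← (volume_preserving_piFinSuccAbove (fun _ : Fin (n+1) => ℝ) 0).symm.lintegral_comp_emb
        (MeasurableEquiv.measurableEmbedding _), 
      ← lintegral_prod_mul (hf 0).aemeasurable (Finset.measurable_prod _ (fun i _ => (hf i.succ).comp (measurable_pi_apply i))).aemeasurable]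
    simp_rw [MeasurableEquiv.piFinSuccAbove_symm_apply, Fin.insertNthEquiv,
      Fin.prod_univ_succ, Fin.insertNth_zero, Equiv.coe_fn_mk, Fin.cons_succ, Fin.cons_zero]
    rfl

lemma aux_half (s : ℝ) (hs : 0 ≤ s) :
    ∫⁻ x in Set.Icc 0 s, ‖x‖ₑ ^ (-(2/3) : ℝ) ≤ ENNReal.ofReal (3 * s ^ (1/3:ℝ)) := by
  rw [← setLIntegral_congr (Ioc_ae_eq_Icc)]
  have : ∫⁻ x in Set.Ioc 0 s, ‖x‖ₑ ^ (-(2/3) : ℝ) = ∫⁻ x in Set.Ioc 0 s, ENNReal.ofReal (x ^ (-(2/3) : ℝ)) := by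
    apply setLIntegral_congr_fun measurableSet_Ioc
    intro x hx
    simp only
    rw [← ENNReal.ofReal_rpow_of_pos hx.1, Real.enorm_eq_ofReal hx.1.le]
  rw [this, ← ofReal_integral_eq_lintegral_ofReal, ← intervalIntegral.integral_of_le hs, integral_rpow (by norm_num)]
  · apply ENNReal.ofReal_le_ofReal
    norm_num
    linarith
  · rw [← IntegrableOn, ← intervalIntegrable_iff_integrableOn_Ioc_of_le hs]
    exact intervalIntegral.intervalIntegrable_rpow' (by norm_num)
  · filter_upwards [ae_restrict_mem measurableSet_Ioc] with x hx
    exact Real.rpow_nonneg hx.1.le _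

lemma aux_one (s : ℝ) (hs : 0 ≤ s) :
    ∫⁻ x in Set.Icc (-s) s, ‖x‖ₑ ^ (-(2/3) : ℝ) ≤ ENNReal.ofReal (6 * s ^ (1/3:ℝ)) := by
  have h2 : ∫⁻ x in Set.Icc (-s) 0, ‖x‖ₑ ^ (-(2/3) : ℝ) = ∫⁻ x in Set.Icc 0 s, ‖x‖ₑ ^ (-(2/3) : ℝ) := by
    rw [← (Measure.measurePreserving_neg (volume : Measure ℝ)).setLIntegral_comp_preimage_emb
      (MeasurableEquiv.neg ℝ).measurableEmbedding]
    simp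
  have : Set.Icc (-s) s = Set.Icc (-s) 0 ∪ Set.Icc 0 s := by
    rw [Set.Icc_union_Icc_eq_Icc] <;> linarith
  rw [this]
  refine (lintegral_union_le _ _ _).trans ?_
  rw [h2]
  refine (add_le_add (aux_half s hs) (aux_half s hs)).trans ?_
  rw [← ENNReal.ofReal_add (by positivity) (by positivity)]
  apply ENNReal.ofReal_le_ofReal
  linarith

lemma aux_slab (L s : ℝ) (hL : 0 ≤ L) (hs : 0 ≤ s) :
    ∫⁻ k in {k : EuclideanSpace ℝ (Fin 3) | ‖k‖ < L ∧ |k 0| ≤ s}, ‖k‖ₑ ^ (-2 : ℝ) ≤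
      ENNReal.ofReal (216 * L ^ (1/3:ℝ) * L ^ (1/3:ℝ) * s ^ (1/3:ℝ)) := by
  have hm : MeasurableSet {k : EuclideanSpace ℝ (Fin 3) | ‖k‖ < L ∧ |k 0| ≤ s} := by
    measurability
  let b : Fin 3 → ℝ := ![s, L, L]
  have hb : ∀ i, 0 ≤ b i := by
    intro i; fin_cases i <;> simp [b, hL, hs]
  let g : Fin 3 → ℝ → ℝ≥0∞ := fun i => (Set.Icc (-(b i)) (b i)).indicator (fun x => ‖x‖ₑ ^ (-(2/3) : ℝ))
  have hg : ∀ i, Measurable (g i) := by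
    intro i
    apply Measurable.indicator _ measurableSet_Icc
    fun_prop
  rw [← lintegral_indicator hm]
  calc _ ≤ ∫⁻ k : EuclideanSpace ℝ (Fin 3), ∏ i, g i (k i) := by
        apply lintegral_mono
        intro k
        by_cases hk : k ∈ {k : EuclideanSpace ℝ (Fin 3) | ‖k‖ < L ∧ |k 0| ≤ s}
        · rw [Set.indicator_of_mem hk]
          have h1 : ∀ i, |k i| ≤ b i := by
            intro i
            have := PiLp.norm_apply_le k i
            rw [Real.norm_eq_abs] at this
            fin_cases i <;> simp [b] <;> first | exact hk.2 | exact this.trans hk.1.le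
          have h2 : ∀ i, g i (k i) = ‖k i‖ₑ ^ (-(2/3) : ℝ) := by
            intro i
            have hmem : k i ∈ Set.Icc (-(b i)) (b i) := abs_le.1 (h1 i)
            simp only [g]
            rw [Set.indicator_of_mem hmem]
          have h3 : ∀ i, ‖k‖ₑ ^ (-(2/3) : ℝ) ≤ g i (k i) := by
            intro i
            rw [h2, ENNReal.rpow_neg, ENNReal.rpow_neg]
            apply ENNReal.inv_le_inv.2
            apply ENNReal.rpow_le_rpow _ (by norm_num)
            exact enorm_le_iff_norm_le.2 (PiLp.norm_apply_le k i)
          calc ‖k‖ₑ ^ (-2 : ℝ) = ∏ i : Fin 3, ‖k‖ₑ ^ (-(2/3) : ℝ) := by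
                rw [Finset.prod_const, ← ENNReal.rpow_natCast, ← ENNReal.rpow_mul]
                norm_num
            _ ≤ _ := Finset.prod_le_prod' (fun i _ => h3 i)
        · rw [Set.indicator_of_notMem hk]; exact zero_le
    _ = ∫⁻ x : Fin 3 → ℝ, ∏ i, g i (x i) := by
        rw [← (PiLp.volume_preserving_ofLp (Fin 3)).lintegral_comp]
        exact Finset.measurable_prod _ (fun i _ => (hg i).comp (measurable_pi_apply i))
    _ = ∏ i, ∫⁻ x, g i x := aux_pi g hg
    _ ≤ ∏ i, ENNReal.ofReal (6 * (b i) ^ (1/3:ℝ)) := by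
        apply Finset.prod_le_prod'
        intro i _
        rw [lintegral_indicator measurableSet_Icc]
        exact aux_one _ (hb i)
    _ = _ := by
        rw [← ENNReal.ofReal_prod_of_nonneg]
        · congr 1
          simp [Fin.prod_univ_three, b]
          ring
        · intro i _
          have := hb i
          positivity

lemma aux_shell (L : ℝ) (hL : 0 < L) : ∃ C : ℝ, 0 ≤ C ∧ ∀ w : ℝ, 0 ≤ w →
    ∫⁻ k in {k : EuclideanSpace ℝ (Fin 3) | ‖k‖ < L ∧ L - w ≤ ‖k‖}, ‖k‖ₑ ^ (-2 : ℝ) ≤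
      ENNReal.ofReal (C * w) := by
  set T : ℝ := 216 * L ^ (1/3:ℝ) * L ^ (1/3:ℝ) * L ^ (1/3:ℝ) with hT
  have hT0 : 0 ≤ T := by positivity
  set c : ℝ := (volume (Metric.ball (0 : EuclideanSpace ℝ (Fin 3)) 1)).toReal with hc
  have hc' : volume (Metric.ball (0 : EuclideanSpace ℝ (Fin 3)) 1) = ENNReal.ofReal c :=
    (ENNReal.ofReal_toReal measure_ball_lt_top.ne).symm
  have hc0 : 0 ≤ c := ENNReal.toReal_nonneg
  refine ⟨T * (2 / L) + (L/2)^(-2:ℝ) * (3 * L^2 * c), by positivity, fun w hw => ?_⟩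
  by_cases h : w ≤ L / 2
  · have hset : {k : EuclideanSpace ℝ (Fin 3) | ‖k‖ < L ∧ L - w ≤ ‖k‖} = 
      Metric.ball 0 L \ Metric.ball 0 (L - w) := by
      ext k; simp
    have hvol : volume {k : EuclideanSpace ℝ (Fin 3) | ‖k‖ < L ∧ L - w ≤ ‖k‖} ≤
        ENNReal.ofReal (3 * L^2 * c * w) := by
      rw [hset, measure_sdiff (Metric.ball_subset_ball (by linarith)) measurableSet_ball.nullMeasurableSet
        measure_ball_lt_top.ne, Measure.addHaar_ball _ 0 hL.le, Measure.addHaar_ball _ 0 (by linarith : 0 ≤ L - w), hc']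
      rw [← ENNReal.ofReal_mul (by positivity), ← ENNReal.ofReal_mul (pow_nonneg (by linarith) _),
        ← ENNReal.ofReal_sub _ (mul_nonneg (pow_nonneg (by linarith) _) hc0)]
      apply ENNReal.ofReal_le_ofReal
      simp only [finrank_euclideanSpace, Fintype.card_fin]
      have : L^3 - (L-w)^3 ≤ 3 * L^2 * w := by nlinarith [mul_nonneg hw hw, mul_nonneg (mul_nonneg hw hw) (by linarith : 0 ≤ L - w), mul_nonneg (mul_nonneg hw hw) hL.le]
      nlinarith
    calc _ ≤ ∫⁻ k in {k : EuclideanSpace ℝ (Fin 3) | ‖k‖ < L ∧ L - w ≤ ‖k‖}, ENNReal.ofReal ((L/2)^(-2:ℝ)) := by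
          apply setLIntegral_mono measurable_const
          rintro k ⟨_, hk⟩
          rw [← ENNReal.ofReal_rpow_of_pos (by positivity), ENNReal.rpow_neg, ENNReal.rpow_neg]
          apply ENNReal.inv_le_inv.2
          apply ENNReal.rpow_le_rpow _ (by norm_num)
          rw [← ofReal_norm]
          apply ENNReal.ofReal_le_ofReal
          linarith
      _ ≤ ENNReal.ofReal ((L/2)^(-2:ℝ)) * ENNReal.ofReal (3 * L^2 * c * w) := by
          rw [setLIntegral_const]; gcongr
      _ ≤ _ := by
          rw [← ENNReal.ofReal_mul (by positivity)]
          apply ENNReal.ofReal_le_ofReal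
          have : 0 ≤ T * (2 / L) * w := by positivity
          nlinarith
  · calc _ ≤ ∫⁻ k in {k : EuclideanSpace ℝ (Fin 3) | ‖k‖ < L ∧ |k 0| ≤ L}, ‖k‖ₑ ^ (-2 : ℝ) := by
          apply lintegral_mono_set
          rintro k ⟨hk, _⟩
          exact ⟨hk, ((Real.norm_eq_abs _).symm.le.trans (PiLp.norm_apply_le k 0)).trans hk.le⟩
      _ ≤ ENNReal.ofReal T := aux_slab L L hL.le hL.le
      _ ≤ _ := by
          apply ENNReal.ofReal_le_ofReal
          have : 0 ≤ (L/2)^(-2:ℝ) * (3 * L^2 * c) * w := by positivity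
          have h1 : 1 ≤ 2 / L * w := by
            rw [div_mul_eq_mul_div, le_div_iff₀ hL]; linarith
          nlinarith

lemma aux_sq {H : Type*} [NormedAddCommGroup H] (x y : H) :
    (‖x - y‖₊ : ℝ≥0∞) ^ 2 ≤ 2 * (‖y‖ₑ ^ 2 + ‖x‖ₑ ^ 2) := by
  have e : (2 : ℝ≥0∞) = ENNReal.ofReal 2 := by simp
  change ‖x - y‖ₑ ^ 2 ≤ _
  rw [e, ← ofReal_norm, ← ofReal_norm, ← ofReal_norm, ← ENNReal.ofReal_pow (norm_nonneg _),
    ← ENNReal.ofReal_pow (norm_nonneg _), ← ENNReal.ofReal_pow (norm_nonneg _),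
    ← ENNReal.ofReal_add (by positivity) (by positivity), ← ENNReal.ofReal_mul (by norm_num)]
  apply ENNReal.ofReal_le_ofReal
  have := norm_sub_le x y
  nlinarith [norm_nonneg (x - y), norm_nonneg x, norm_nonneg y, sq_nonneg (‖x‖ - ‖y‖)]

lemma aux_good {H : Type*} [NormedAddCommGroup H] [NormedSpace ℝ H] (L A r : ℝ)
    (hA : 0 ≤ A) (hr : 0 < r)
    (F : EuclideanSpace ℝ (Fin 3) → H)
    (F' : EuclideanSpace ℝ (Fin 3) → (EuclideanSpace ℝ (Fin 3) →L[ℝ] H))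
    (hd : ∀ k ∈ {k : EuclideanSpace ℝ (Fin 3) | 0 < ‖k‖ ∧ ‖k‖ < L ∧ 0 < (k 0) ^ 2 + (k 1) ^ 2},
        HasFDerivAt F (F' k) k)
    (hb : ∀ k ∈ {k : EuclideanSpace ℝ (Fin 3) | 0 < ‖k‖ ∧ ‖k‖ < L ∧ 0 < (k 0) ^ 2 + (k 1) ^ 2},
        ‖F' k‖ ≤ A / (‖k‖ * Real.sqrt ((k 0) ^ 2 + (k 1) ^ 2)))
    (a k : EuclideanSpace ℝ (Fin 3)) (ha : 2 * ‖a‖ ≤ r) (hk : ‖k‖ < L - ‖a‖) (hk0 : r < |k 0|) :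
    ‖F (k + a) - F k‖ ≤ 4 * A * ‖a‖ / r ^ 2 := by
  have key : ∀ x ∈ segment ℝ k (k + a), ‖x‖ < L ∧ r / 2 ≤ |x 0| := by
    intro x hx
    rw [segment_eq_image'] at hx
    obtain ⟨t, ⟨ht0, ht1⟩, rfl⟩ := hx
    simp only [add_sub_cancel_left]
    have hta : ‖t • a‖ ≤ ‖a‖ := by
      rw [norm_smul, Real.norm_of_nonneg ht0]
      nlinarith [norm_nonneg a]
    have hta0 : |(t • a) 0| ≤ ‖a‖ := by
      have := PiLp.norm_apply_le (t • a) 0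
      rw [Real.norm_eq_abs] at this
      exact this.trans hta
    constructor
    · have := norm_add_le k (t • a)
      linarith
    · have h1 := abs_sub_abs_le_abs_sub (k 0) (-((t • a) 0))
      rw [abs_neg, sub_neg_eq_add] at h1
      change r / 2 ≤ |k 0 + (t • a) 0|
      linarith
  have hU : ∀ x ∈ segment ℝ k (k + a),
      x ∈ {k : EuclideanSpace ℝ (Fin 3) | 0 < ‖k‖ ∧ ‖k‖ < L ∧ 0 < (k 0) ^ 2 + (k 1) ^ 2} := by
    intro x hx
    obtain ⟨h1, h2⟩ := key x hx
    have h3 : 0 < |x 0| := by linarith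
    have h4 := PiLp.norm_apply_le x 0
    rw [Real.norm_eq_abs] at h4
    refine ⟨by linarith, h1, ?_⟩
    have : 0 < (x 0) ^ 2 := by rw [← sq_abs]; positivity
    positivity
  have hbd : ∀ x ∈ segment ℝ k (k + a), ‖F' x‖ ≤ 4 * A / r ^ 2 := by
    intro x hx
    obtain ⟨h1, h2⟩ := key x hx
    have h4 := PiLp.norm_apply_le x 0
    rw [Real.norm_eq_abs] at h4
    have h5 : r / 2 ≤ Real.sqrt ((x 0) ^ 2 + (x 1) ^ 2) := by
      apply h2.trans
      rw [← Real.sqrt_sq_eq_abs]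
      apply Real.sqrt_le_sqrt
      nlinarith [sq_nonneg (x 1)]
    calc _ ≤ _ := hb x (hU x hx)
      _ ≤ A / ((r / 2) * (r / 2)) := by
          gcongr
          exact h2.trans h4
      _ = _ := by field_simp; try norm_num
  have := (convex_segment k (k + a)).norm_image_sub_le_of_norm_hasFDerivWithin_le
    (fun x hx => (hd x (hU x hx)).hasFDerivWithinAt) hbd
    (left_mem_segment ℝ _ _) (right_mem_segment ℝ _ _)
  rw [add_sub_cancel_left] at this
  calc _ ≤ _ := this
    _ = _ := by ring

lemma aux_core {H : Type*} [NormedAddCommGroup H] [NormedSpace ℝ H] (L A r Cs V : ℝ)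
    (hL : 0 < L) (hA : 0 ≤ A) (hr : 0 < r) (hCs0 : 0 ≤ Cs) (hV0 : 0 ≤ V)
    (hV : volume (Metric.ball (0 : EuclideanSpace ℝ (Fin 3)) L) = ENNReal.ofReal V)
    (hCs : ∀ w : ℝ, 0 ≤ w →
    ∫⁻ k in {k : EuclideanSpace ℝ (Fin 3) | ‖k‖ < L ∧ L - w ≤ ‖k‖}, ‖k‖ₑ ^ (-2 : ℝ) ≤
      ENNReal.ofReal (Cs * w))
    (F : EuclideanSpace ℝ (Fin 3) → H)
    (F' : EuclideanSpace ℝ (Fin 3) → (EuclideanSpace ℝ (Fin 3) →L[ℝ] H))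
    (hF0 : ∀ᵐ k : EuclideanSpace ℝ (Fin 3), L ≤ ‖k‖ → F k = 0)
    (hF1 : ∀ᵐ k : EuclideanSpace ℝ (Fin 3), ‖F k‖ ≤ A / ‖k‖)
    (hd : ∀ k ∈ {k : EuclideanSpace ℝ (Fin 3) | 0 < ‖k‖ ∧ ‖k‖ < L ∧ 0 < (k 0) ^ 2 + (k 1) ^ 2},
        HasFDerivAt F (F' k) k)
    (hb : ∀ k ∈ {k : EuclideanSpace ℝ (Fin 3) | 0 < ‖k‖ ∧ ‖k‖ < L ∧ 0 < (k 0) ^ 2 + (k 1) ^ 2},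
        ‖F' k‖ ≤ A / (‖k‖ * Real.sqrt ((k 0) ^ 2 + (k 1) ^ 2)))
    (a : EuclideanSpace ℝ (Fin 3)) (ha : 2 * ‖a‖ ≤ r) :
    (∫⁻ k : EuclideanSpace ℝ (Fin 3), (‖F (k + a) - F k‖₊ : ℝ≥0∞) ^ 2)
      ≤ ENNReal.ofReal (A ^ 2 * (16 * ‖a‖ ^ 2 / r ^ 4 * V + 4 * (Cs * (2 * ‖a‖) +
        216 * L ^ (1/3:ℝ) * L ^ (1/3:ℝ) * (r + ‖a‖) ^ (1/3:ℝ)))) := by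
  have hh := norm_nonneg a
  let S1 : Set (EuclideanSpace ℝ (Fin 3)) := {k | ‖k‖ < L ∧ L - 2 * ‖a‖ ≤ ‖k‖}
  let S2 : Set (EuclideanSpace ℝ (Fin 3)) := {k | ‖k‖ < L ∧ |k 0| ≤ r + ‖a‖}
  have hS1 : MeasurableSet S1 := by measurability
  have hS2 : MeasurableSet S2 := by measurability
  let W : EuclideanSpace ℝ (Fin 3) → ℝ≥0∞ :=
    (S1 ∪ S2).indicator (fun k => ENNReal.ofReal (A ^ 2) * ‖k‖ₑ ^ (-2 : ℝ))
  have hWm : Measurable W := by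
    apply Measurable.indicator _ (hS1.union hS2)
    fun_prop
  have hW : ∫⁻ k, W k ≤ ENNReal.ofReal (A ^ 2 * (Cs * (2 * ‖a‖) +
        216 * L ^ (1/3:ℝ) * L ^ (1/3:ℝ) * (r + ‖a‖) ^ (1/3:ℝ))) := by
    rw [lintegral_indicator (hS1.union hS2), lintegral_const_mul _ (by fun_prop),
      ENNReal.ofReal_mul (by positivity), ENNReal.ofReal_add (by positivity) (by positivity)]
    gcongr
    refine (lintegral_union_le _ _ _).trans ?_
    exact add_le_add (hCs _ (by positivity)) (aux_slab L _ hL.le (by positivity))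
  have hu : ∀ᵐ k : EuclideanSpace ℝ (Fin 3),
      (L - 2 * ‖a‖ ≤ ‖k‖ ∨ |k 0| ≤ r + ‖a‖) → ‖F k‖ₑ ^ 2 ≤ W k := by
    filter_upwards [hF0, hF1] with k h0 h1 hk
    by_cases hkL : L ≤ ‖k‖
    · simp [h0 hkL]
    · push Not at hkL
      have hmem : k ∈ S1 ∪ S2 := by
        rcases hk with hk | hk
        · exact Or.inl ⟨hkL, hk⟩
        · exact Or.inr ⟨hkL, hk⟩
      simp only [W]
      rw [Set.indicator_of_mem hmem]
      rcases (norm_nonneg k).eq_or_lt with hk0 | hk0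
      · rw [← hk0, div_zero] at h1
        have : F k = 0 := norm_le_zero_iff.1 h1
        simp [this]
      · rw [← ofReal_norm, ← ofReal_norm k, ENNReal.ofReal_rpow_of_pos hk0,
          ← ENNReal.ofReal_mul (by positivity), ← ENNReal.ofReal_pow (norm_nonneg _)]
        apply ENNReal.ofReal_le_ofReal
        calc ‖F k‖ ^ 2 ≤ (A / ‖k‖) ^ 2 := by gcongr
          _ = _ := by
            rw [Real.rpow_neg hk0.le, div_pow, div_eq_mul_inv]
            norm_num
  have hu' := (measurePreserving_add_right (volume : Measure (EuclideanSpace ℝ (Fin 3))) a).quasiMeasurePreserving.ae hu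
  let M := ENNReal.ofReal ((4 * A * ‖a‖ / r ^ 2) ^ 2)
  have hpt : ∀ᵐ k : EuclideanSpace ℝ (Fin 3), (‖F (k + a) - F k‖₊ : ℝ≥0∞) ^ 2 ≤
      (Metric.ball (0 : EuclideanSpace ℝ (Fin 3)) L).indicator (fun _ => M) k + 2 * (W k + W (k + a)) := by
    filter_upwards [hu, hu'] with k h1 h2
    by_cases hk : ‖k‖ < L - ‖a‖ ∧ r < |k 0|
    · have hmem : k ∈ Metric.ball (0 : EuclideanSpace ℝ (Fin 3)) L := by
        rw [mem_ball_zero_iff]; linarith [hk.1]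
      rw [Set.indicator_of_mem hmem]
      refine le_add_right ?_
      have := aux_good L A r hA hr F F' hd hb a k ha hk.1 hk.2
      change ‖F (k + a) - F k‖ₑ ^ 2 ≤ _
      rw [← ofReal_norm, ← ENNReal.ofReal_pow (norm_nonneg _)]
      apply ENNReal.ofReal_le_ofReal
      gcongr
    · refine le_add_left ((aux_sq _ _).trans ?_)
      have hk' : L - ‖a‖ ≤ ‖k‖ ∨ |k 0| ≤ r := by
        by_contra hcon
        push Not at hcon
        exact hk hcon
      gcongr
      · apply h1
        rcases hk' with h | h
        · left; linarith
        · right; linarith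
      · apply h2
        rcases hk' with h | h
        · left
          have := norm_sub_le (k + a) a
          rw [add_sub_cancel_right] at this
          linarith
        · right
          have h4 := PiLp.norm_apply_le a 0
          rw [Real.norm_eq_abs] at h4
          have := abs_add_le (k 0) (a 0)
          change |k 0 + a 0| ≤ _
          linarith
  calc _ ≤ _ := lintegral_mono_ae hpt
    _ = M * ENNReal.ofReal V + 2 * ((∫⁻ k, W k) + (∫⁻ k, W k)) := by
        rw [lintegral_add_left (Measurable.indicator measurable_const measurableSet_ball),
          lintegral_indicator measurableSet_ball, setLIntegral_const, hV, 
          lintegral_const_mul _ (by fun_prop), lintegral_add_left hWm,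
          lintegral_add_right_eq_self (μ := volume) W a]
    _ ≤ _ := by
        refine (add_le_add le_rfl (mul_le_mul_right (add_le_add hW hW) 2)).trans ?_
        rw [two_mul, ← ENNReal.ofReal_add (by positivity) (by positivity),
          ← ENNReal.ofReal_add (by positivity) (by positivity), ← ENNReal.ofReal_mul (by positivity),
          ← ENNReal.ofReal_add (by positivity) (by positivity)]
        apply ENNReal.ofReal_le_ofReal
        apply le_of_eq
        field_simp
        ring

/-- Hölder-type continuity in the mean: if `F : ℝ³ → H` is supported in `{|k| ≤ Λ}`, satisfies
`‖F(k)‖ ≤ A/|k|` a.e. and `‖F′(k)‖ ≤ A/(|k| √(k₁² + k₂²))` on the set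
`U = {0 < |k| < Λ, k₁² + k₂² > 0}` where it is continuously differentiable, then
`∫ ‖F(k+a) - F(k)‖² dk ≤ C A² |a|^δ` for `0 < |a| ≤ Λ/2`, with `δ > 0` and `C` depending
only on `Λ`. -/
theorem shift_difference_bound (Λ : ℝ) (hΛ : 0 < Λ) :
    ∃ δ : ℝ, 0 < δ ∧ ∃ C : ℝ, 0 ≤ C ∧
      ∀ (H : Type) (_ : NormedAddCommGroup H) (_ : @InnerProductSpace ℂ H _ _)
        (_ : CompleteSpace H)
        (A : ℝ), 0 ≤ A →
      ∀ (F : EuclideanSpace ℝ (Fin 3) → H)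
        (F' : EuclideanSpace ℝ (Fin 3) → (EuclideanSpace ℝ (Fin 3) →L[ℝ] H)),
      AEStronglyMeasurable F volume →
      (∀ᵐ k : EuclideanSpace ℝ (Fin 3), Λ ≤ ‖k‖ → F k = 0) →
      (∀ᵐ k : EuclideanSpace ℝ (Fin 3), ‖F k‖ ≤ A / ‖k‖) →
      (∀ k ∈ {k : EuclideanSpace ℝ (Fin 3) | 0 < ‖k‖ ∧ ‖k‖ < Λ ∧ 0 < (k 0) ^ 2 + (k 1) ^ 2},
        HasFDerivAt F (F' k) k) →
      ContinuousOn F'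
        {k : EuclideanSpace ℝ (Fin 3) | 0 < ‖k‖ ∧ ‖k‖ < Λ ∧ 0 < (k 0) ^ 2 + (k 1) ^ 2} →
      (∀ k ∈ {k : EuclideanSpace ℝ (Fin 3) | 0 < ‖k‖ ∧ ‖k‖ < Λ ∧ 0 < (k 0) ^ 2 + (k 1) ^ 2},
        ‖F' k‖ ≤ A / (‖k‖ * Real.sqrt ((k 0) ^ 2 + (k 1) ^ 2))) →
      ∀ a : EuclideanSpace ℝ (Fin 3), 0 < ‖a‖ → ‖a‖ ≤ Λ / 2 →
        (∫⁻ k : EuclideanSpace ℝ (Fin 3), (‖F (k + a) - F k‖₊ : ℝ≥0∞) ^ 2)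
          ≤ ENNReal.ofReal (C * A ^ 2 * ‖a‖ ^ δ) := by
  obtain ⟨Cs, hCs0, hCs⟩ := aux_shell Λ hΛ
  set V : ℝ := (volume (Metric.ball (0 : EuclideanSpace ℝ (Fin 3)) Λ)).toReal with hVd
  have hV : volume (Metric.ball (0 : EuclideanSpace ℝ (Fin 3)) Λ) = ENNReal.ofReal V :=
    (ENNReal.ofReal_toReal measure_ball_lt_top.ne).symm
  have hV0 : 0 ≤ V := ENNReal.toReal_nonneg
  set q : ℝ := Λ ^ (11/12 : ℝ) with hq
  set p : ℝ := Λ ^ (3/4 : ℝ) with hp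
  have hp0 : 0 < p := by positivity
  have hq0 : 0 < q := by positivity
  refine ⟨1/12, by norm_num, q / Λ ^ 3 * V + 4 * (Cs * (2 * q) +
    216 * Λ ^ (1/3:ℝ) * Λ ^ (1/3:ℝ) * (4 * p) ^ (1/3:ℝ)), by positivity, ?_⟩
  intro H _ _ _ A hA F F' _ hF0 hF1 hd _ hb a ha haL
  set h := ‖a‖ with hh
  have hhL : h ≤ Λ := by linarith
  set r : ℝ := 2 * p * h ^ (1/4 : ℝ) with hr
  have hr0 : 0 < r := by positivity
  have hsplit : h ^ (3/4 : ℝ) * h ^ (1/4 : ℝ) = h := by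
    rw [← Real.rpow_add ha]; norm_num
  have hsplit2 : h ^ (11/12 : ℝ) * h ^ (1/12 : ℝ) = h := by
    rw [← Real.rpow_add ha]; norm_num
  have h2r : 2 * h ≤ r := by
    have : h ^ (3/4 : ℝ) ≤ p := Real.rpow_le_rpow ha.le hhL (by norm_num)
    have h4 : 0 < h ^ (1/4 : ℝ) := by positivity
    nlinarith
  have hhq : h ≤ q * h ^ (1/12 : ℝ) := by
    have : h ^ (11/12 : ℝ) ≤ q := Real.rpow_le_rpow ha.le hhL (by norm_num)
    have h4 : 0 < h ^ (1/12 : ℝ) := by positivity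
    nlinarith
  have hr4 : r ^ 4 = 16 * Λ ^ 3 * h := by
    have e1 : p ^ 4 = Λ ^ 3 := by
      rw [hp, ← Real.rpow_natCast, ← Real.rpow_natCast, ← Real.rpow_mul hΛ.le]; norm_num
    have e2 : (h ^ (1/4 : ℝ)) ^ 4 = h := by
      rw [← Real.rpow_natCast, ← Real.rpow_mul ha.le]; norm_num
    rw [hr, mul_pow, mul_pow, e1, e2]; norm_num
  have hrh : (r + h) ^ (1/3 : ℝ) ≤ (4 * p) ^ (1/3 : ℝ) * h ^ (1/12 : ℝ) := by
    have e : h ^ (1/12 : ℝ) = (h ^ (1/4 : ℝ)) ^ (1/3 : ℝ) := by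
      rw [← Real.rpow_mul ha.le]; norm_num
    rw [e, ← Real.mul_rpow (by positivity) (by positivity)]
    apply Real.rpow_le_rpow (by positivity) _ (by norm_num)
    linarith
  refine (aux_core Λ A r Cs V hΛ hA hr0 hCs0 hV0 hV hCs F F' hF0 hF1 hd hb a h2r).trans ?_
  apply ENNReal.ofReal_le_ofReal
  rw [← hh, mul_comm _ (A ^ 2), mul_assoc (A ^ 2)]
  apply mul_le_mul_of_nonneg_left _ (by positivity)
  have t1 : 16 * h ^ 2 / r ^ 4 * V ≤ q / Λ ^ 3 * V * h ^ (1/12 : ℝ) := by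
    have : 16 * h ^ 2 / r ^ 4 = h / Λ ^ 3 := by rw [hr4]; field_simp
    rw [this]
    calc h / Λ ^ 3 * V ≤ (q * h ^ (1/12 : ℝ)) / Λ ^ 3 * V := by gcongr
      _ = _ := by ring
  have t2 : Cs * (2 * h) ≤ Cs * (2 * (q * h ^ (1/12 : ℝ))) := by gcongr
  have t3 : 216 * Λ ^ (1/3:ℝ) * Λ ^ (1/3:ℝ) * (r + h) ^ (1/3:ℝ) ≤
    216 * Λ ^ (1/3:ℝ) * Λ ^ (1/3:ℝ) * ((4 * p) ^ (1/3 : ℝ) * h ^ (1/12 : ℝ)) := by gcongr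
  linarith
end

section
/- For k = (k₁, k₂, k₃) ∈ ℝ³ with k₁² + k₂² > 0 define the polarization vectors ε₁(k) = (k₂, −k₁, 0)/√(k₁² + k₂²) and ε₂(k) = (k/|k|) × ε₁(k), where × denotes the vector cross product in ℝ³. Then ε₁ and ε₂ are differentiable at every such k, and there exists a constant C such that for λ = 1, 2 and l = 1, 2, 3 one has |∂ε_λ(k)/∂k_l| ≤ C/√(k₁² + k₂²) for all k with k₁² + k₂² > 0. -/
/-- The cross product on `ℝ³` (as Euclidean space). -/
noncomputable def cross3 (u v : EuclideanSpace ℝ (Fin 3)) : EuclideanSpace ℝ (Fin 3) :=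
  (WithLp.equiv 2 (Fin 3 → ℝ)).symm
    ![u 1 * v 2 - u 2 * v 1, u 2 * v 0 - u 0 * v 2, u 0 * v 1 - u 1 * v 0]

/-- The first polarization vector `ε₁(k) = (k₂, -k₁, 0)/√(k₁² + k₂²)`. -/
noncomputable def polVec1 (k : EuclideanSpace ℝ (Fin 3)) : EuclideanSpace ℝ (Fin 3) :=
  (Real.sqrt ((k 0) ^ 2 + (k 1) ^ 2))⁻¹ •
    (WithLp.equiv 2 (Fin 3 → ℝ)).symm ![k 1, -(k 0), 0]

/-- The second polarization vector `ε₂(k) = (k/|k|) × ε₁(k)`. -/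
noncomputable def polVec2 (k : EuclideanSpace ℝ (Fin 3)) : EuclideanSpace ℝ (Fin 3) :=
  cross3 (‖k‖⁻¹ • k) (polVec1 k)


abbrev E3 := EuclideanSpace ℝ (Fin 3)

lemma normalize_deriv (v : E3) (hv : v ≠ 0) :
    ∃ D : E3 →L[ℝ] E3, HasFDerivAt (fun v : E3 => ‖v‖⁻¹ • v) D v ∧
      ∀ w, ‖D w‖ ≤ 2 * ‖w‖ / ‖v‖ := by
  have hn : 0 < ‖v‖ := norm_pos_iff.mpr hv
  have h1 : DifferentiableAt ℝ (fun v : E3 => ‖v‖) v :=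
    (contDiffAt_norm ℝ hv (n := 1)).differentiableAt (by norm_num)
  have h2 : ‖fderiv ℝ (fun v : E3 => ‖v‖) v‖ ≤ 1 := by
    have := norm_fderiv_le_of_lipschitz ℝ (x₀ := v) (lipschitzWith_one_norm (E := E3))
    simpa using this
  have h3 := (hasDerivAt_inv hn.ne').comp_hasFDerivAt v h1.hasFDerivAt
  have h4 := h3.smul (hasFDerivAt_id v)
  refine ⟨_, h4, fun w => ?_⟩
  have h5 : ‖fderiv ℝ (fun v : E3 => ‖v‖) v w‖ ≤ ‖w‖ := by
    simpa using ContinuousLinearMap.le_of_opNorm_le _ h2 w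
  simp only [ContinuousLinearMap.add_apply, ContinuousLinearMap.smul_apply,
    ContinuousLinearMap.smulRight_apply, ContinuousLinearMap.id_apply, Function.comp, id]
  refine (norm_add_le _ _).trans ?_
  simp only [norm_smul, norm_neg, norm_inv, norm_pow, norm_norm]
  have h6 : (‖v‖ ^ 2)⁻¹ * ‖fderiv ℝ (fun v : E3 => ‖v‖) v w‖ * ‖v‖ ≤ (‖v‖ ^ 2)⁻¹ * ‖w‖ * ‖v‖ := by
    gcongr
  have h7 : ‖v‖⁻¹ * ‖w‖ + (‖v‖ ^ 2)⁻¹ * ‖w‖ * ‖v‖ = 2 * ‖w‖ / ‖v‖ := by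
    field_simp
    ring
  linarith

lemma norm_cross3_le (u v : E3) : ‖cross3 u v‖ ≤ ‖u‖ * ‖v‖ := by
  refine abs_le_of_sq_le_sq' ?_ (by positivity) |>.2
  rw [mul_pow]
  simp only [EuclideanSpace.norm_sq_eq, Fin.sum_univ_three, Real.norm_eq_abs, sq_abs]
  simp [cross3]
  nlinarith [sq_nonneg (u 0 * v 0 + u 1 * v 1 + u 2 * v 2)]

lemma cross3_bilin : IsBoundedBilinearMap ℝ (fun p : E3 × E3 => cross3 p.1 p.2) where
  add_left x y z := by ext i; fin_cases i <;> simp [cross3] <;> ring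
  smul_left c x y := by ext i; fin_cases i <;> simp [cross3] <;> ring
  add_right x y z := by ext i; fin_cases i <;> simp [cross3] <;> ring
  smul_right c x y := by ext i; fin_cases i <;> simp [cross3] <;> ring
  bound := ⟨1, one_pos, fun x y => by simpa using norm_cross3_le x y⟩

noncomputable def projP : E3 →L[ℝ] E3 := LinearMap.toContinuousLinearMap
  { toFun := fun k => (WithLp.equiv 2 (Fin 3 → ℝ)).symm ![k 1, -(k 0), 0]
    map_add' := fun x y => by ext i; fin_cases i <;> simp <;> ring
    map_smul' := fun c x => by ext i; fin_cases i <;> simp }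

lemma projP_apply (k : E3) :
    projP k = (WithLp.equiv 2 (Fin 3 → ℝ)).symm ![k 1, -(k 0), 0] := rfl

lemma norm_projP (k : E3) : ‖projP k‖ = Real.sqrt ((k 0) ^ 2 + (k 1) ^ 2) := by
  rw [EuclideanSpace.norm_eq, projP_apply]
  simp [Fin.sum_univ_three, add_comm]

lemma norm_projP_le (k : E3) : ‖projP k‖ ≤ ‖k‖ := by
  rw [norm_projP, EuclideanSpace.norm_eq]
  apply Real.sqrt_le_sqrt
  simp [Fin.sum_univ_three]
  positivity

lemma polVec1_eq : polVec1 = fun k => ‖projP k‖⁻¹ • projP k := by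
  funext k
  rw [norm_projP]
  rfl

lemma norm_unit_le (v : E3) : ‖‖v‖⁻¹ • v‖ ≤ 1 := by
  rw [norm_smul, norm_inv, norm_norm]
  exact inv_mul_le_one

/-- The polarization vectors `ε₁, ε₂` are differentiable at every `k` with `k₁² + k₂² > 0`,
with all partial derivatives bounded by `C/√(k₁² + k₂²)` for a uniform constant `C`. -/
theorem polVec_deriv_bound :
    ∃ C : ℝ, ∀ k : EuclideanSpace ℝ (Fin 3), 0 < (k 0) ^ 2 + (k 1) ^ 2 →
      (DifferentiableAt ℝ polVec1 k ∧ DifferentiableAt ℝ polVec2 k) ∧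
      ∀ l : Fin 3,
        ‖fderiv ℝ polVec1 k (EuclideanSpace.single l 1)‖
            ≤ C / Real.sqrt ((k 0) ^ 2 + (k 1) ^ 2) ∧
        ‖fderiv ℝ polVec2 k (EuclideanSpace.single l 1)‖
            ≤ C / Real.sqrt ((k 0) ^ 2 + (k 1) ^ 2) := by
  refine ⟨4, fun k hk => ?_⟩
  rw [← norm_projP]
  have hp : 0 < ‖projP k‖ := by rw [norm_projP]; exact Real.sqrt_pos.mpr hk
  have hpk := norm_projP_le k
  have hk0 : 0 < ‖k‖ := hp.trans_le hpk
  obtain ⟨D, hD, hDb⟩ := normalize_deriv (projP k) (norm_pos_iff.mp hp)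
  obtain ⟨F, hF, hFb⟩ := normalize_deriv k (norm_pos_iff.mp hk0)
  have h1 : HasFDerivAt polVec1 (D.comp projP) k := by
    rw [polVec1_eq]
    exact HasFDerivAt.comp k hD projP.hasFDerivAt
  have h2 : HasFDerivAt polVec2
      ((cross3_bilin.deriv (‖k‖⁻¹ • k, polVec1 k)).comp (F.prod (D.comp projP))) k :=
    HasFDerivAt.comp (g := fun p : E3 × E3 => cross3 p.1 p.2)
      (f := fun k : E3 => (‖k‖⁻¹ • k, polVec1 k)) k (cross3_bilin.hasFDerivAt (‖k‖⁻¹ • k, polVec1 k)) (hF.prodMk h1)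
  refine ⟨⟨h1.differentiableAt, h2.differentiableAt⟩, fun l => ?_⟩
  rw [h1.fderiv, h2.fderiv]
  set e : E3 := EuclideanSpace.single l 1 with he
  have hen : ‖e‖ = 1 := by simp [he]
  have b1 : ‖D (projP e)‖ ≤ 2 / ‖projP k‖ := by
    refine (hDb _).trans ?_
    have := norm_projP_le e
    gcongr
    linarith
  have b2 : ‖F e‖ ≤ 2 / ‖projP k‖ := by
    refine (hFb _).trans ?_
    rw [hen, mul_one]
    gcongr
  have n1 : ‖polVec1 k‖ ≤ 1 := by rw [polVec1_eq]; exact norm_unit_le _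
  have n2 := norm_unit_le k
  have hpos : 0 ≤ 2 / ‖projP k‖ := by positivity
  have h4 : 4 / ‖projP k‖ = 2 / ‖projP k‖ + 2 / ‖projP k‖ := by ring
  rw [h4]
  constructor
  · change ‖D (projP e)‖ ≤ _
    linarith
  · change ‖cross3 (‖k‖⁻¹ • k) (D (projP e)) + cross3 (F e) (polVec1 k)‖ ≤ _
    refine (norm_add_le _ _).trans (add_le_add ?_ ?_)
    · refine (norm_cross3_le _ _).trans ?_
      calc _ ≤ 1 * (2 / ‖projP k‖) := by gcongr
        _ = _ := one_mul _
    · refine (norm_cross3_le _ _).trans ?_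
      calc _ ≤ (2 / ‖projP k‖) * 1 := by gcongr
        _ = _ := mul_one _
end
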